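/- arXiv:2404.10489 — 2 statements merged into one kernel-verified Lean document; each statement's English description precedes it below -/
import Mathlib

section
/- For every real t > 0 and r ≥ 0 there holds ∫₀^∞ e^{−ω²/2} sin(ωt) J₀(rω) dω = ∫₀^t x · exp(−(r−x)²/2) · Ĩ₀(rx) / √(t² − x²) dx. -/
open MeasureTheory

/-- Bessel function of the first kind of order 0: `J₀(x) = (1/π)∫₀^π cos(x sin φ) dφ`. -/
noncomputable def J0 (x : ℝ) : ℝ :=
  (1 / Real.pi) * ∫ φ in (0 : ℝ)..Real.pi, Real.cos (x * Real.sin φ)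

/-- Modified Bessel function of the first kind of order 0: `I₀(z) = (1/π)∫₀^π e^{z cos φ} dφ`. -/
noncomputable def besselI0 (z : ℝ) : ℝ :=
  (1 / Real.pi) * ∫ φ in (0 : ℝ)..Real.pi, Real.exp (z * Real.cos φ)

/-- `Ĩ₀(z) = e^{−z} I₀(z)`. -/
noncomputable def Itilde0 (z : ℝ) : ℝ := Real.exp (-z) * besselI0 z

lemma hasSum_of_eq {f g : ℕ → ℝ} {a : ℝ} (h : ∀ k, f k = g k) (hg : HasSum g a) : HasSum f a := by
  rw [funext h]; exact hg

lemma hasSum_ii {F : ℕ → ℝ → ℝ} {f : ℝ → ℝ} {c : ℕ → ℝ} (a b : ℝ)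
    (hF : ∀ n, Continuous (F n)) (hb : ∀ n x, |F n x| ≤ c n)
    (hc : Summable c) (hs : ∀ x, HasSum (fun n => F n x) (f x)) :
    HasSum (fun n => ∫ x in a..b, F n x) (∫ x in a..b, f x) := by
  refine intervalIntegral.hasSum_integral_of_dominated_convergence (fun n _ => c n) ?_ ?_ ?_ ?_ ?_
  · exact fun n => (hF n).aestronglyMeasurable
  · exact fun n => Filter.Eventually.of_forall fun x _ => hb n x
  · exact Filter.Eventually.of_forall fun x _ => hc
  · exact intervalIntegrable_const
  · exact Filter.Eventually.of_forall fun x _ => hs x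

lemma prod_even (k : ℕ) : ∏ i ∈ Finset.range k, ((2 * (i:ℝ) + 1) / (2 * i + 2))
    = ((2 * k).factorial : ℝ) / (4 ^ k * (k.factorial : ℝ) ^ 2) := by
  induction k with
  | zero => simp
  | succ k ih =>
    have h : ((2 * (k + 1)).factorial : ℝ) = (2 * k + 2) * ((2 * k + 1) * (2 * k).factorial) := by
      have : 2 * (k + 1) = 2 * k + 1 + 1 := by ring
      rw [this, Nat.factorial_succ, Nat.factorial_succ]; push_cast; ring
    have hk : (k.factorial : ℝ) ≠ 0 := by positivity
    rw [Finset.prod_range_succ, ih, h, Nat.factorial_succ]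
    push_cast
    have h1 : (k : ℝ) + 1 ≠ 0 := by positivity
    have h2 : (2 * k : ℝ) + 2 ≠ 0 := by positivity
    field_simp
    ring

lemma prod_odd (k : ℕ) : ∏ i ∈ Finset.range k, ((2 * (i:ℝ) + 2) / (2 * i + 3))
    = (4 ^ k * (k.factorial : ℝ) ^ 2) / ((2 * k + 1).factorial : ℝ) := by
  induction k with
  | zero => simp
  | succ k ih =>
    have h : ((2 * (k + 1) + 1).factorial : ℝ)
        = (2 * k + 3) * ((2 * k + 2) * (2 * k + 1).factorial) := by
      have : 2 * (k + 1) + 1 = 2 * k + 1 + 1 + 1 := by ring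
      rw [this, Nat.factorial_succ, Nat.factorial_succ (2 * k + 1)]; push_cast; ring
    have hk : ((2 * k + 1).factorial : ℝ) ≠ 0 := by positivity
    rw [Finset.prod_range_succ, ih, h, Nat.factorial_succ k]
    push_cast
    have h2 : (2 * k : ℝ) + 2 ≠ 0 := by positivity
    have h3 : (2 * k : ℝ) + 3 ≠ 0 := by positivity
    field_simp
    ring

lemma hasSum_J0 (x : ℝ) :
    HasSum (fun k : ℕ => (-1) ^ k * x ^ (2 * k) / (4 ^ k * (k.factorial : ℝ) ^ 2)) (J0 x) := by
  have h := hasSum_ii (F := fun k φ => (-1) ^ k * (x * Real.sin φ) ^ (2 * k) / ((2 * k).factorial : ℝ))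
    (f := fun φ => Real.cos (x * Real.sin φ))
    (c := fun k => |(-1) ^ k * x ^ (2 * k) / ((2 * k).factorial : ℝ)|) 0 Real.pi
    (fun n => by fun_prop) (fun n φ => by
      rw [abs_div, abs_div]
      gcongr ?_ / _
      rw [mul_pow, ← mul_assoc, abs_mul]
      refine mul_le_of_le_one_right (abs_nonneg _) ?_
      rw [abs_pow]
      exact pow_le_one₀ (abs_nonneg _) (Real.abs_sin_le_one φ))
    (Real.hasSum_cos x).summable.abs (fun φ => Real.hasSum_cos _)
  have h2 := h.mul_left (1 / Real.pi)
  unfold J0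
  refine hasSum_of_eq (fun k => ?_) h2
  have e : ∀ φ : ℝ, (-1) ^ k * (x * Real.sin φ) ^ (2 * k) / ((2 * k).factorial : ℝ)
      = ((-1) ^ k * x ^ (2 * k) / ((2 * k).factorial : ℝ)) * Real.sin φ ^ (2 * k) := by
    intro φ; rw [mul_pow]; ring
  simp only [e]
  rw [intervalIntegral.integral_const_mul, integral_sin_pow_even, prod_even]
  have := Real.pi_ne_zero
  field_simp

lemma continuous_J0 : Continuous J0 := by
  unfold J0
  refine continuous_const.mul ?_
  refine intervalIntegral.continuous_parametric_intervalIntegral_of_continuous' ?_ _ _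
  unfold Function.uncurry
  fun_prop

lemma abs_J0_le (x : ℝ) : |J0 x| ≤ 1 := by
  unfold J0
  have h := intervalIntegral.norm_integral_le_of_norm_le_const (a := 0) (b := Real.pi)
    (f := fun φ => Real.cos (x * Real.sin φ)) (C := 1) (fun φ _ => Real.abs_cos_le_one _)
  rw [Real.norm_eq_abs, sub_zero, abs_of_pos Real.pi_pos, one_mul] at h
  rw [abs_mul, abs_of_pos (by positivity), one_div, inv_mul_le_iff₀ Real.pi_pos]
  simpa using h

lemma sin_eq (a : ℝ) : ∫ θ in (0:ℝ)..Real.pi / 2, a * Real.cos θ * J0 (a * Real.cos θ)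
    = Real.sin a := by
  have h := hasSum_ii
    (F := fun k θ => (a * Real.cos θ) *
      ((-1) ^ k * (a * Real.cos θ) ^ (2 * k) / (4 ^ k * (k.factorial : ℝ) ^ 2)))
    (f := fun θ => a * Real.cos θ * J0 (a * Real.cos θ))
    (c := fun k => |a| * |(-1) ^ k * a ^ (2 * k) / (4 ^ k * (k.factorial : ℝ) ^ 2)|) 0 (Real.pi / 2)
    (fun n => by fun_prop) (fun n φ => by
      rw [abs_mul]
      gcongr ?_ * ?_
      · rw [abs_mul]
        exact mul_le_of_le_one_right (abs_nonneg _) (Real.abs_cos_le_one φ)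
      rw [abs_div, abs_div]
      gcongr ?_ / _
      rw [mul_pow, ← mul_assoc, abs_mul]
      refine mul_le_of_le_one_right (abs_nonneg _) ?_
      rw [abs_pow]
      exact pow_le_one₀ (abs_nonneg _) (Real.abs_cos_le_one φ))
    ((hasSum_J0 a).summable.abs.mul_left _) (fun φ => (hasSum_J0 _).mul_left _)
  refine h.unique ?_
  convert Real.hasSum_sin a using 1
  funext k
  have e : ∀ φ : ℝ, (a * Real.cos φ) *
      ((-1) ^ k * (a * Real.cos φ) ^ (2 * k) / (4 ^ k * (k.factorial : ℝ) ^ 2))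
      = ((-1) ^ k * a ^ (2 * k + 1) / (4 ^ k * (k.factorial : ℝ) ^ 2)) * Real.cos φ ^ (2 * k + 1) := by
    intro φ; rw [mul_pow]; ring
  simp only [e]
  rw [intervalIntegral.integral_const_mul, EulerSine.integral_cos_pow_eq, integral_sin_pow_odd,
    prod_odd]
  field_simp

lemma integrable_mom (k : ℕ) :
    IntegrableOn (fun x : ℝ => x ^ k * Real.exp (-x ^ 2 / 2)) (Set.Ioi 0) := by
  have h := integrableOn_rpow_mul_exp_neg_mul_sq (b := 1 / 2) (by norm_num) (s := k)
    (by have : (0:ℝ) ≤ k := by positivity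
        linarith)
  refine h.congr_fun (fun x _ => ?_) measurableSet_Ioi
  simp only [Real.rpow_natCast]
  congr 2; ring

lemma integral_mom (k : ℕ) :
    ∫ x in Set.Ioi (0:ℝ), x ^ (2 * k + 1) * Real.exp (-x ^ 2 / 2) = 2 ^ k * (k.factorial : ℝ) := by
  have h := integral_rpow_mul_exp_neg_mul_rpow (p := 2) (q := ((2 * k + 1 : ℕ) : ℝ)) (b := 1 / 2)
    (by norm_num)
    (by have : (0:ℝ) ≤ ((2 * k + 1 : ℕ) : ℝ) := by positivity
        linarith) (by norm_num)
  have e1 : ((((2 * k + 1 : ℕ) : ℝ)) + 1) / 2 = k + 1 := by push_cast; ring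
  have e2 : -((((2 * k + 1 : ℕ) : ℝ)) + 1) / 2 = -((k + 1 : ℕ) : ℝ) := by push_cast; ring
  rw [e1, e2, Real.Gamma_nat_eq_factorial, Real.rpow_neg (by norm_num), Real.rpow_natCast] at h
  have e3 : ((1 / 2 : ℝ) ^ (k + 1))⁻¹ * (1 / 2) = 2 ^ k := by
    rw [one_div, inv_pow, inv_inv, pow_succ]; ring
  rw [e3] at h
  rw [← h]
  refine setIntegral_congr_fun measurableSet_Ioi (fun x _ => ?_)
  simp only [Real.rpow_natCast, Real.rpow_ofNat]
  congr 2; ring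

lemma hankel (s : ℝ) : ∫ x in Set.Ioi (0:ℝ), x * Real.exp (-x ^ 2 / 2) * J0 (x * s)
    = Real.exp (-s ^ 2 / 2) := by
  set F : ℕ → ℝ → ℝ := fun k x => ((-1) ^ k * s ^ (2 * k) / (4 ^ k * (k.factorial : ℝ) ^ 2)) *
    (x ^ (2 * k + 1) * Real.exp (-x ^ 2 / 2)) with hF
  have hi : ∀ k, Integrable (F k) (volume.restrict (Set.Ioi 0)) := fun k =>
    (integrable_mom _).const_mul _
  have key : ∀ k : ℕ, 4 ^ k * (k.factorial : ℝ) ^ 2 = (2 ^ k * (k.factorial : ℝ)) * (2 ^ k * (k.factorial : ℝ)) := by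
    intro k
    rw [show (4:ℝ) = 2 * 2 by norm_num, mul_pow]; ring
  have hn : ∀ k, ∫ x in Set.Ioi (0:ℝ), ‖F k x‖ = (s ^ 2 / 2) ^ k / (k.factorial : ℝ) := by
    intro k
    have : ∫ x in Set.Ioi (0:ℝ), ‖F k x‖ = ∫ x in Set.Ioi (0:ℝ),
        (s ^ (2 * k) / (4 ^ k * (k.factorial : ℝ) ^ 2)) *
          (x ^ (2 * k + 1) * Real.exp (-x ^ 2 / 2)) := by
      refine setIntegral_congr_fun measurableSet_Ioi (fun x hx => ?_)
      have hx' : (0:ℝ) < x := hx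
      simp only [hF, norm_mul, norm_div, norm_pow, Real.norm_eq_abs, abs_neg, abs_one, one_pow, one_mul]
      rw [abs_of_pos hx', abs_of_pos (Real.exp_pos _), pow_mul |s|, sq_abs, ← pow_mul]
      simp
    rw [this, integral_const_mul, integral_mom, key, div_pow, pow_mul]
    field_simp
  have hsum := hasSum_integral_of_summable_integral_norm hi (by
    simp only [hn]; exact Real.summable_pow_div_factorial _)
  have e1 : ∫ x in Set.Ioi (0:ℝ), x * Real.exp (-x ^ 2 / 2) * J0 (x * s)
      = ∫ x in Set.Ioi (0:ℝ), ∑' k, F k x := by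
    refine setIntegral_congr_fun measurableSet_Ioi (fun x _ => ?_)
    refine ((((hasSum_J0 (x * s)).mul_left (x * Real.exp (-x ^ 2 / 2))).tsum_eq).symm).trans ?_
    refine tsum_congr fun k => ?_
    simp only [hF]
    rw [mul_pow]; ring
  rw [e1]
  refine hsum.unique ?_
  have h2 := NormedSpace.expSeries_div_hasSum_exp (𝔸 := ℝ) (-s ^ 2 / 2)
  rw [← Real.exp_eq_exp_ℝ] at h2
  refine hasSum_of_eq (fun k => ?_) h2
  simp only [hF]
  rw [integral_const_mul, integral_mom, key, div_pow, neg_pow (s ^ 2), pow_mul s]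
  field_simp

lemma half_period (f : ℝ → ℝ) (hf : Continuous f) :
    ∫ φ in (0:ℝ)..2 * Real.pi, f (Real.cos φ) = 2 * ∫ φ in (0:ℝ)..Real.pi, f (Real.cos φ) := by
  have hc : Continuous fun φ => f (Real.cos φ) := by fun_prop
  have h1 := intervalIntegral.integral_add_adjacent_intervals (a := 0) (b := Real.pi)
    (c := 2 * Real.pi) (hc.intervalIntegrable (μ := volume) _ _) (hc.intervalIntegrable _ _)
  have h2 := intervalIntegral.integral_comp_sub_left (a := 0) (b := Real.pi)
    (fun φ => f (Real.cos φ)) (2 * Real.pi)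
  simp only [Real.cos_two_pi_sub] at h2
  rw [show 2 * Real.pi - Real.pi = Real.pi by ring, sub_zero] at h2
  rw [← h1, ← h2]; ring

lemma J0_cos (a : ℝ) : ∫ ψ in (0:ℝ)..2 * Real.pi, Real.cos (a * Real.cos ψ)
    = 2 * Real.pi * J0 a := by
  have hp : Function.Periodic (fun ψ => Real.cos (a * Real.cos ψ)) Real.pi := by
    intro ψ; simp [Real.cos_add_pi]
  rw [half_period (fun y => Real.cos (a * y)) (by fun_prop)]
  have h1 := hp.intervalIntegral_add_eq 0 (-(Real.pi / 2))
  have h2 := intervalIntegral.integral_comp_sub_right (a := 0) (b := Real.pi)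
    (fun φ => Real.cos (a * Real.cos φ)) (Real.pi / 2)
  simp only [Real.cos_sub_pi_div_two] at h2
  rw [zero_add] at h1
  rw [h1, show -(Real.pi / 2) + Real.pi = Real.pi - Real.pi / 2 by ring,
    show -(Real.pi / 2) = 0 - Real.pi / 2 by ring, ← h2]
  unfold J0
  have := Real.pi_ne_zero
  field_simp

lemma J0_rot (a b : ℝ) : ∫ ψ in (0:ℝ)..2 * Real.pi, Real.cos (a * Real.cos ψ + b * Real.sin ψ)
    = 2 * Real.pi * J0 (Real.sqrt (a ^ 2 + b ^ 2)) := by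
  set z : ℂ := ⟨a, b⟩ with hz
  have h1 : ‖z‖ * Real.cos z.arg = a := Complex.norm_mul_cos_arg z
  have h2 : ‖z‖ * Real.sin z.arg = b := Complex.norm_mul_sin_arg z
  have h3 : Real.sqrt (a ^ 2 + b ^ 2) = ‖z‖ := by
    rw [Complex.norm_eq_sqrt_sq_add_sq]
  rw [h3, ← J0_cos]
  have e : ∀ ψ, Real.cos (a * Real.cos ψ + b * Real.sin ψ)
      = Real.cos (‖z‖ * Real.cos (ψ - z.arg)) := by
    intro ψ
    rw [Real.cos_sub]
    congr 1
    linear_combination (-Real.cos ψ) * h1 - Real.sin ψ * h2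
  simp only [e]
  rw [intervalIntegral.integral_comp_sub_right (fun ψ => Real.cos (‖z‖ * Real.cos ψ))]
  have hp : Function.Periodic (fun ψ => Real.cos (‖z‖ * Real.cos ψ)) (2 * Real.pi) := by
    intro ψ; simp
  have := hp.intervalIntegral_add_eq (0 - z.arg) 0
  rw [zero_add] at this
  rw [← this]; congr 1; ring

lemma avg_shift (u x ψ : ℝ) :
    ∫ φ in (0:ℝ)..2 * Real.pi, Real.cos (u - x * Real.cos (φ + ψ))
      = Real.cos u * (2 * Real.pi * J0 x) := by
  rw [intervalIntegral.integral_comp_add_right (fun φ => Real.cos (u - x * Real.cos φ))]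
  have hp : Function.Periodic (fun φ => Real.cos (u - x * Real.cos φ)) (2 * Real.pi) := by
    intro ψ; simp
  have := hp.intervalIntegral_add_eq (0 + ψ) 0
  rw [show 2 * Real.pi + ψ = 0 + ψ + 2 * Real.pi by ring, this, zero_add]
  simp only [Real.cos_sub]
  rw [intervalIntegral.integral_add ((by fun_prop : Continuous _).intervalIntegrable _ _)
    ((by fun_prop : Continuous _).intervalIntegrable _ _), intervalIntegral.integral_const_mul,
    intervalIntegral.integral_const_mul, J0_cos]
  have h0 : ∫ φ in (0:ℝ)..2 * Real.pi, Real.sin (x * Real.cos φ) = 0 := by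
    rw [half_period (fun y => Real.sin (x * y)) (by fun_prop)]
    have h2 := intervalIntegral.integral_comp_sub_left (a := 0) (b := Real.pi)
      (fun φ => Real.sin (x * Real.cos φ)) Real.pi
    simp only [Real.cos_pi_sub, mul_neg, Real.sin_neg, intervalIntegral.integral_neg, sub_self, sub_zero] at h2
    linarith
  rw [h0]; ring

lemma swap_ii (f : ℝ → ℝ → ℝ) (hf : Continuous (Function.uncurry f)) (a b c d : ℝ) (hab : a ≤ b) (hcd : c ≤ d) :
    ∫ x in a..b, ∫ y in c..d, f x y = ∫ y in c..d, ∫ x in a..b, f x y := by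
  simp only [intervalIntegral.integral_of_le hab, intervalIntegral.integral_of_le hcd]
  refine integral_integral_swap ?_
  rw [Measure.prod_restrict]
  refine IntegrableOn.mono_set (t := Set.Icc a b ×ˢ Set.Icc c d) ?_
    (Set.prod_mono Set.Ioc_subset_Icc_self Set.Ioc_subset_Icc_self)
  exact hf.continuousOn.integrableOn_compact (isCompact_Icc.prod isCompact_Icc)

lemma J0_mul (r x : ℝ) :
    ∫ φ in (0:ℝ)..2 * Real.pi, J0 (Real.sqrt (r ^ 2 + x ^ 2 - 2 * r * x * Real.cos φ))
      = 2 * Real.pi * (J0 r * J0 x) := by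
  have hpi : (0:ℝ) ≤ 2 * Real.pi := by positivity
  have e : ∀ φ, 2 * Real.pi * J0 (Real.sqrt (r ^ 2 + x ^ 2 - 2 * r * x * Real.cos φ))
      = ∫ ψ in (0:ℝ)..2 * Real.pi, Real.cos (r * Real.cos ψ - x * Real.cos (φ + ψ)) := by
    intro φ
    have := J0_rot (r - x * Real.cos φ) (x * Real.sin φ)
    rw [show (r - x * Real.cos φ) ^ 2 + (x * Real.sin φ) ^ 2
      = r ^ 2 + x ^ 2 - 2 * r * x * Real.cos φ by
        linear_combination x ^ 2 * Real.sin_sq_add_cos_sq φ] at this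
    rw [← this]
    congr 1; funext ψ
    rw [Real.cos_add φ ψ]; congr 1; ring
  have h : 2 * Real.pi * ∫ φ in (0:ℝ)..2 * Real.pi,
      J0 (Real.sqrt (r ^ 2 + x ^ 2 - 2 * r * x * Real.cos φ))
      = 2 * Real.pi * (2 * Real.pi * (J0 r * J0 x)) := by
    rw [← intervalIntegral.integral_const_mul]
    simp only [e]
    rw [swap_ii _ (by unfold Function.uncurry; fun_prop) _ _ _ _ hpi hpi]
    simp only [avg_shift]
    rw [intervalIntegral.integral_mul_const, J0_cos]; ring
  exact mul_left_cancel₀ (by positivity) h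

lemma swap_gauss (g : ℝ → ℝ → ℝ) (hg : Continuous (Function.uncurry g)) (C : ℝ)
    (hb : ∀ x y, |g x y| ≤ C) (a b : ℝ) (hab : a ≤ b) :
    ∫ x in Set.Ioi (0:ℝ), (∫ y in a..b, x * Real.exp (-x ^ 2 / 2) * g x y)
      = ∫ y in a..b, ∫ x in Set.Ioi (0:ℝ), x * Real.exp (-x ^ 2 / 2) * g x y := by
  simp only [intervalIntegral.integral_of_le hab]
  refine integral_integral_swap ?_
  have h1 : Integrable (fun x : ℝ => x * Real.exp (-x ^ 2 / 2)) (volume.restrict (Set.Ioi 0)) := by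
    have := integrable_mom 1
    simp only [pow_one] at this
    exact this
  have h2 : Integrable (fun _ : ℝ => (1:ℝ)) (volume.restrict (Set.Ioc a b)) :=
    integrable_const _
  have h3 := h1.mul_prod h2
  have h4 := h3.mul_bdd (c := C) (g := fun z : ℝ × ℝ => g z.1 z.2) hg.aestronglyMeasurable
    (Filter.Eventually.of_forall fun z => hb z.1 z.2)
  simp only [mul_one] at h4
  exact h4

lemma weber (r x : ℝ) :
    ∫ w in Set.Ioi (0:ℝ), w * Real.exp (-w ^ 2 / 2) * (J0 (r * w) * J0 (w * x))
      = Real.exp (-(r - x) ^ 2 / 2) * Itilde0 (r * x) := by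
  have hpi : (0:ℝ) ≤ 2 * Real.pi := by positivity
  have hpos : ∀ φ, 0 ≤ r ^ 2 + x ^ 2 - 2 * r * x * Real.cos φ := by
    intro φ
    have : r ^ 2 + x ^ 2 - 2 * r * x * Real.cos φ
      = (r - x * Real.cos φ) ^ 2 + (x * Real.sin φ) ^ 2 := by
        linear_combination (-x ^ 2) * Real.sin_sq_add_cos_sq φ
    rw [this]; positivity
  have h := swap_gauss
    (fun w φ => J0 (w * Real.sqrt (r ^ 2 + x ^ 2 - 2 * r * x * Real.cos φ)))
    (by
      have := continuous_J0
      unfold Function.uncurry; fun_prop) 1 (fun _ _ => abs_J0_le _) 0 (2 * Real.pi) hpi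
  simp only [hankel, intervalIntegral.integral_const_mul] at h
  have e1 : ∫ w in Set.Ioi (0:ℝ), w * Real.exp (-w ^ 2 / 2) *
      (∫ φ in (0:ℝ)..2 * Real.pi, J0 (w * Real.sqrt (r ^ 2 + x ^ 2 - 2 * r * x * Real.cos φ)))
      = 2 * Real.pi * ∫ w in Set.Ioi (0:ℝ), w * Real.exp (-w ^ 2 / 2) * (J0 (r * w) * J0 (w * x)) := by
    rw [← integral_const_mul]
    refine setIntegral_congr_fun measurableSet_Ioi (fun w hw => ?_)
    have hw' : (0:ℝ) ≤ w := le_of_lt hw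
    have := J0_mul (r * w) (w * x)
    have e : ∀ φ, Real.sqrt ((r * w) ^ 2 + (w * x) ^ 2 - 2 * (r * w) * (w * x) * Real.cos φ)
        = w * Real.sqrt (r ^ 2 + x ^ 2 - 2 * r * x * Real.cos φ) := by
      intro φ
      rw [show (r * w) ^ 2 + (w * x) ^ 2 - 2 * (r * w) * (w * x) * Real.cos φ
        = w ^ 2 * (r ^ 2 + x ^ 2 - 2 * r * x * Real.cos φ) by ring,
        Real.sqrt_mul (sq_nonneg w), Real.sqrt_sq hw']
    simp only [e] at this
    simp only [this]; ring
  rw [e1] at h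
  have e2 : ∫ φ in (0:ℝ)..2 * Real.pi,
      Real.exp (-Real.sqrt (r ^ 2 + x ^ 2 - 2 * r * x * Real.cos φ) ^ 2 / 2)
      = 2 * Real.pi * (Real.exp (-(r - x) ^ 2 / 2) * Itilde0 (r * x)) := by
    have e : ∀ φ, Real.exp (-Real.sqrt (r ^ 2 + x ^ 2 - 2 * r * x * Real.cos φ) ^ 2 / 2)
        = Real.exp (-(r - x) ^ 2 / 2) * Real.exp (-(r * x)) * Real.exp (r * x * Real.cos φ) := by
      intro φ
      rw [Real.sq_sqrt (hpos φ), ← Real.exp_add, ← Real.exp_add]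
      congr 1; ring
    simp only [e]
    rw [intervalIntegral.integral_const_mul,
      half_period (fun y => Real.exp (r * x * y)) (by fun_prop)]
    unfold Itilde0 besselI0
    have := Real.pi_ne_zero
    field_simp
  rw [e2] at h
  exact mul_left_cancel₀ (by positivity) h

lemma subst_cos (t : ℝ) (ht : 0 < t) (G : ℝ → ℝ) :
    ∫ x in (0:ℝ)..t, x * G x / Real.sqrt (t ^ 2 - x ^ 2)
      = ∫ θ in (0:ℝ)..Real.pi / 2, t * Real.cos θ * G (t * Real.cos θ) := by
  have hpi : (0:ℝ) ≤ Real.pi / 2 := by positivity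
  rw [intervalIntegral.integral_of_le ht.le, intervalIntegral.integral_of_le hpi,
    integral_Ioc_eq_integral_Ioo, integral_Ioc_eq_integral_Ioo]
  have him : (fun θ => t * Real.cos θ) '' Set.Ioo 0 (Real.pi / 2) = Set.Ioo 0 t := by
    ext x
    constructor
    · rintro ⟨θ, ⟨h1, h2⟩, rfl⟩
      have hc : 0 < Real.cos θ := Real.cos_pos_of_mem_Ioo ⟨by linarith, h2⟩
      have hc1 : Real.cos θ < 1 := by
        have := Real.cos_lt_cos_of_nonneg_of_le_pi_div_two le_rfl h2.le h1
        simpa using this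
      exact ⟨by positivity, by simpa using mul_lt_mul_of_pos_left hc1 ht⟩
    · rintro ⟨h1, h2⟩
      refine ⟨Real.arccos (x / t), ⟨?_, ?_⟩, ?_⟩
      · rw [Real.arccos_pos, div_lt_one ht]; exact h2
      · rw [Real.arccos_lt_pi_div_two]; positivity
      · have : x / t ≤ 1 := by rw [div_le_one ht]; exact h2.le
        have h0 : 0 ≤ x / t := by positivity
        simp only
        rw [Real.cos_arccos (by linarith) this]
        field_simp
  rw [← him, integral_image_eq_integral_abs_deriv_smul (f' := fun θ => t * -Real.sin θ)
    measurableSet_Ioo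
    (fun θ _ => ((Real.hasDerivAt_cos θ).const_mul t).hasDerivWithinAt)
    (by
      intro a ha b hb hab
      refine Real.injOn_cos ⟨ha.1.le, ?_⟩ ⟨hb.1.le, ?_⟩ (mul_left_cancel₀ ht.ne' hab)
      · linarith [ha.2]
      · linarith [hb.2])]
  refine setIntegral_congr_fun measurableSet_Ioo (fun θ hθ => ?_)
  have hs : 0 < Real.sin θ := Real.sin_pos_of_pos_of_lt_pi hθ.1 (by linarith [hθ.2, Real.pi_pos])
  have e : Real.sqrt (t ^ 2 - (t * Real.cos θ) ^ 2) = t * Real.sin θ := by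
    rw [show t ^ 2 - (t * Real.cos θ) ^ 2 = (t * Real.sin θ) ^ 2 by
      linear_combination (-t ^ 2) * Real.sin_sq_add_cos_sq θ]
    exact Real.sqrt_sq (by positivity)
  have e2 : |t * -Real.sin θ| = t * Real.sin θ := by
    rw [mul_neg, abs_neg, abs_of_pos (by positivity)]
  simp only [smul_eq_mul]
  rw [e, e2]
  field_simp

theorem stmt_13 (t r : ℝ) (ht : 0 < t) (hr : 0 ≤ r) :
    (∫ ω in Set.Ioi (0 : ℝ), Real.exp (-ω ^ 2 / 2) * Real.sin (ω * t) * J0 (r * ω)) =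
      ∫ x in (0 : ℝ)..t,
        x * Real.exp (-(r - x) ^ 2 / 2) * Itilde0 (r * x) / Real.sqrt (t ^ 2 - x ^ 2) := by
  have hpi : (0:ℝ) ≤ Real.pi / 2 := by positivity
  have h := swap_gauss
    (fun w θ => (t * Real.cos θ) * (J0 (r * w) * J0 (w * (t * Real.cos θ))))
    (by
      have := continuous_J0
      unfold Function.uncurry; fun_prop) t (fun w θ => by
        rw [abs_mul, abs_mul, abs_mul, abs_of_pos ht]
        have h1 := Real.abs_cos_le_one θ
        have h2 := abs_J0_le (r * w)
        have h3 := abs_J0_le (w * (t * Real.cos θ))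
        have h4 : |J0 (r * w)| * |J0 (w * (t * Real.cos θ))| ≤ 1 :=
          mul_le_one₀ h2 (abs_nonneg _) h3
        have h5 : |Real.cos θ| * (|J0 (r * w)| * |J0 (w * (t * Real.cos θ))|) ≤ 1 :=
          mul_le_one₀ h1 (by positivity) h4
        rw [mul_assoc]
        exact mul_le_of_le_one_right ht.le h5) 0 (Real.pi / 2) hpi
  have e1 : ∫ ω in Set.Ioi (0 : ℝ), Real.exp (-ω ^ 2 / 2) * Real.sin (ω * t) * J0 (r * ω)
      = ∫ w in Set.Ioi (0:ℝ), ∫ θ in (0:ℝ)..Real.pi / 2, w * Real.exp (-w ^ 2 / 2) *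
        ((t * Real.cos θ) * (J0 (r * w) * J0 (w * (t * Real.cos θ)))) := by
    refine setIntegral_congr_fun measurableSet_Ioi (fun w _ => ?_)
    rw [← sin_eq, ← intervalIntegral.integral_const_mul, ← intervalIntegral.integral_mul_const]
    congr 1; funext θ
    rw [mul_assoc w t]; ring
  rw [e1, h]
  have e2 := subst_cos t ht (fun x => Real.exp (-(r - x) ^ 2 / 2) * Itilde0 (r * x))
  have e3 : ∫ x in (0 : ℝ)..t,
        x * Real.exp (-(r - x) ^ 2 / 2) * Itilde0 (r * x) / Real.sqrt (t ^ 2 - x ^ 2)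
      = ∫ x in (0 : ℝ)..t,
        x * (Real.exp (-(r - x) ^ 2 / 2) * Itilde0 (r * x)) / Real.sqrt (t ^ 2 - x ^ 2) := by
    congr 1; funext x; ring
  rw [e3, e2]
  congr 1; funext θ
  rw [← weber r (t * Real.cos θ), ← integral_const_mul]
  congr 1; funext w
  ring
end

section
/- For every real t ≥ 0 and r ≥ 0 there holds ∫₀^∞ ω e^{−ω²/2} J₁(rω) sin(tω) dω = −t² 𝒥_{1,2}(t,r) + r t 𝒥_{0,1}(t,r), where 𝒥_{j,n}(t,r) = ∫₀^1 exp(−(r−t+tξ)²/2) · Ĩⱼ(rt(1−ξ)) · (1−ξ)ⁿ / (√ξ · √(2−ξ)) dξ. -/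
open MeasureTheory

/-- Bessel function of the first kind of order 1: `J₁(x) = (1/π)∫₀^π cos(φ − x sin φ) dφ`. -/
noncomputable def J1 (x : ℝ) : ℝ :=
  (1 / Real.pi) * ∫ φ in (0 : ℝ)..Real.pi, Real.cos (φ - x * Real.sin φ)

/-- Modified Bessel function of the first kind of integer order `j`:
`Iⱼ(z) = (1/π)∫₀^π e^{z cos φ} cos(jφ) dφ`. -/
noncomputable def besselI (j : ℕ) (z : ℝ) : ℝ :=
  (1 / Real.pi) * ∫ φ in (0 : ℝ)..Real.pi, Real.exp (z * Real.cos φ) * Real.cos (j * φ)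

/-- `Ĩⱼ(z) = e^{−z} Iⱼ(z)`. -/
noncomputable def Itilde (j : ℕ) (z : ℝ) : ℝ := Real.exp (-z) * besselI j z

/-- `𝒥_{j,n}(t,r) = ∫₀^1 exp(−(r−t+tξ)²/2) Ĩⱼ(rt(1−ξ)) (1−ξ)ⁿ / (√ξ √(2−ξ)) dξ`. -/
noncomputable def Jjn (j n : ℕ) (t r : ℝ) : ℝ :=
  ∫ ξ in (0 : ℝ)..1,
    Real.exp (-(r - t + t * ξ) ^ 2 / 2) * Itilde j (r * t * (1 - ξ)) * (1 - ξ) ^ n /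
      (Real.sqrt ξ * Real.sqrt (2 - ξ))

open Real Set

lemma gi0 : Integrable (fun x : ℝ => exp (-x ^ 2 / 2)) := by
  have := integrable_exp_neg_mul_sq (b := 1/2) (by norm_num)
  refine this.congr (Filter.Eventually.of_forall fun x => ?_)
  simp only; congr 1; ring

lemma gi1 : Integrable (fun x : ℝ => x * exp (-x ^ 2 / 2)) := by
  have := integrable_mul_exp_neg_mul_sq (b := 1/2) (by norm_num)
  refine this.congr (Filter.Eventually.of_forall fun x => ?_)
  simp only; congr 2; ring

lemma gi2 : Integrable (fun x : ℝ => x ^ 2 * exp (-x ^ 2 / 2)) := by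
  have := integrable_rpow_mul_exp_neg_mul_sq (b := 1/2) (by norm_num) (s := 2) (by norm_num)
  refine this.congr (Filter.Eventually.of_forall fun x => ?_)
  simp only
  rw [show (2:ℝ) = ((2:ℕ):ℝ) by norm_num, Real.rpow_natCast]
  congr 2; push_cast; ring

lemma gcos (b : ℝ) : ∫ x : ℝ, exp (-x ^ 2 / 2) * cos (b * x) = √(2 * π) * exp (-b ^ 2 / 2) := by
  have h := fourierIntegral_gaussian (b := 1/2) (by norm_num) (b : ℂ)
  have hi : Integrable (fun x : ℝ => Complex.exp (Complex.I * b * x) * Complex.exp (-(1/2) * (x:ℂ) ^ 2)) := by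
    have := (gi0.ofReal (𝕜 := ℂ)).bdd_mul (f := fun x : ℝ => Complex.exp (Complex.I * b * x)) (c := 1)
      (by fun_prop) (Filter.Eventually.of_forall fun x => by
        rw [show Complex.I * b * x = ((b * x : ℝ) : ℂ) * Complex.I by push_cast; ring]
        rw [Complex.norm_exp_ofReal_mul_I])
    refine this.congr (Filter.Eventually.of_forall fun x => ?_)
    simp only
    congr 1
    simp only [Complex.ofReal_exp, Complex.coe_algebraMap]
    congr 1; push_cast; ring
  have h2 := congrArg Complex.re h
  rw [← Complex.reCLM_apply, ← ContinuousLinearMap.integral_comp_comm _ hi] at h2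
  convert h2 using 1
  · congr 1; ext x
    simp only [Complex.reCLM_apply]
    rw [show Complex.I * b * x = ((b * x : ℝ) : ℂ) * Complex.I by push_cast; ring,
      show -(1/2) * (x:ℂ)^2 = ((-x^2/2 : ℝ) : ℂ) by push_cast; ring, ← Complex.ofReal_exp,
      Complex.re_mul_ofReal, Complex.exp_ofReal_mul_I_re]
    ring
  · rw [show (π:ℂ) / (1/2) = ((2 * π : ℝ) : ℂ) by push_cast; ring,
      show (1/2 : ℂ) = ((1/2 : ℝ) : ℂ) by push_cast; ring,
      ← Complex.ofReal_cpow (by positivity),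
      show -(b:ℂ)^2 / (4 * ((1/2 : ℝ) : ℂ)) = ((-b^2/2 : ℝ) : ℂ) by push_cast; ring,
      ← Complex.ofReal_exp, ← Complex.ofReal_mul, Complex.ofReal_re, Real.sqrt_eq_rpow]

lemma gsin (b : ℝ) : ∫ x : ℝ, exp (-x ^ 2 / 2) * sin (b * x) = 0 := by
  have := integral_neg_eq_self (fun x : ℝ => exp (-x ^ 2 / 2) * sin (b * x)) volume
  have h2 : (fun x : ℝ => exp (-(-x) ^ 2 / 2) * sin (b * (-x))) = fun x => -(exp (-x ^ 2 / 2) * sin (b * x)) := by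
    ext x; simp
  rw [h2, integral_neg] at this
  linarith

lemma gicos (b : ℝ) : Integrable (fun x : ℝ => exp (-x ^ 2 / 2) * cos (b * x)) := by
  exact gi0.mul_bdd (c := 1) (by fun_prop) (Filter.Eventually.of_forall fun x => by
    simpa using abs_cos_le_one _)

lemma gisin (b : ℝ) : Integrable (fun x : ℝ => exp (-x ^ 2 / 2) * sin (b * x)) := by
  exact gi0.mul_bdd (c := 1) (by fun_prop) (Filter.Eventually.of_forall fun x => by
    simpa using abs_sin_le_one _)

lemma gixsin (b : ℝ) : Integrable (fun x : ℝ => x * exp (-x ^ 2 / 2) * sin (b * x)) := by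
  exact gi1.mul_bdd (c := 1) (by fun_prop) (Filter.Eventually.of_forall fun x => by
    simpa using abs_sin_le_one _)

lemma gixcos (b : ℝ) : Integrable (fun x : ℝ => x * exp (-x ^ 2 / 2) * cos (b * x)) := by
  exact gi1.mul_bdd (c := 1) (by fun_prop) (Filter.Eventually.of_forall fun x => by
    simpa using abs_cos_le_one _)

lemma gxsin (b : ℝ) : ∫ x : ℝ, x * exp (-x ^ 2 / 2) * sin (b * x) = √(2 * π) * (b * exp (-b ^ 2 / 2)) := by
  have h := integral_eq_zero_of_hasDerivAt_of_integrable
    (f := fun x : ℝ => exp (-x ^ 2 / 2) * sin (b * x))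
    (f' := fun x : ℝ => b * (exp (-x ^ 2 / 2) * cos (b * x)) - x * exp (-x ^ 2 / 2) * sin (b * x))
    (fun x => by
      have h1 : HasDerivAt (fun x : ℝ => -x ^ 2 / 2) (-x) x := by
        have := ((hasDerivAt_pow 2 x).neg).div_const 2
        exact this.congr_deriv (by push_cast; ring)
      have h2 : HasDerivAt (fun x : ℝ => b * x) b x := by
        simpa using (hasDerivAt_id x).const_mul b
      exact (h1.exp.mul h2.sin).congr_deriv (by ring))
    (((gicos b).const_mul b).sub (gixsin b)) (gisin b)
  rw [integral_sub ((gicos b).const_mul b) (gixsin b), integral_const_mul, gcos] at h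
  linarith

lemma g2 (r p q : ℝ) : ∫ k : ℝ × ℝ, k.1 * exp (-k.1 ^ 2 / 2) * exp (-k.2 ^ 2 / 2) * sin (r * k.1)
      * cos (p * k.1 + q * k.2) =
    π * ((r + p) * exp (-(r + p) ^ 2 / 2) + (r - p) * exp (-(r - p) ^ 2 / 2)) * exp (-q ^ 2 / 2) := by
  have e : ∀ k : ℝ × ℝ, k.1 * exp (-k.1 ^ 2 / 2) * exp (-k.2 ^ 2 / 2) * sin (r * k.1)
      * cos (p * k.1 + q * k.2) =
      ((1/2) * (k.1 * exp (-k.1 ^ 2 / 2) * sin ((r+p) * k.1) + k.1 * exp (-k.1 ^ 2 / 2) * sin ((r-p) * k.1)))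
        * (exp (-k.2 ^ 2 / 2) * cos (q * k.2)) -
      ((1/2) * (k.1 * exp (-k.1 ^ 2 / 2) * cos ((r-p) * k.1) - k.1 * exp (-k.1 ^ 2 / 2) * cos ((r+p) * k.1)))
        * (exp (-k.2 ^ 2 / 2) * sin (q * k.2)) := by
    intro k
    rw [cos_add, add_mul, sub_mul, sin_add, sin_sub, cos_sub, cos_add]; ring
  simp_rw [e]
  have i1 := ((gixsin (r+p)).add (gixsin (r-p))).const_mul (1/2)
  have i2 := ((gixcos (r-p)).sub (gixcos (r+p))).const_mul (1/2)
  simp only [Pi.add_apply, Pi.sub_apply] at i1 i2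
  rw [Measure.volume_eq_prod]
  rw [integral_sub (i1.mul_prod (gicos q)) (i2.mul_prod (gisin q))]
  rw [integral_prod_mul (fun x : ℝ => (1/2) * (x * exp (-x ^ 2 / 2) * sin ((r+p) * x) + x * exp (-x ^ 2 / 2) * sin ((r-p) * x))) (fun y : ℝ => exp (-y ^ 2 / 2) * cos (q * y)),
    integral_prod_mul (fun x : ℝ => (1/2) * (x * exp (-x ^ 2 / 2) * cos ((r-p) * x) - x * exp (-x ^ 2 / 2) * cos ((r+p) * x))) (fun y : ℝ => exp (-y ^ 2 / 2) * sin (q * y)),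
    gsin, gcos, integral_const_mul, integral_add (gixsin _) (gixsin _), gxsin, gxsin]
  have : √(2*π) * √(2*π) = 2 * π := Real.mul_self_sqrt (by positivity)
  linear_combination (1/2) * (((r + p) * exp (-(r + p) ^ 2 / 2) + (r - p) * exp (-(r - p) ^ 2 / 2)) * exp (-q ^ 2 / 2)) * this

lemma hasSum_int (c : ℕ → ℝ) (hc : Summable c) (F : ℕ → ℝ → ℝ) (f : ℝ → ℝ)
    (hF : ∀ n, Continuous (F n)) (hb : ∀ n x, |F n x| ≤ c n) (hs : ∀ x, HasSum (fun n => F n x) (f x)) (a b : ℝ) :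
    HasSum (fun n => ∫ x in a..b, F n x) (∫ x in a..b, f x) := by
  refine intervalIntegral.hasSum_integral_of_dominated_convergence (fun n _ => c n)
    (fun n => (hF n).aestronglyMeasurable) (fun n => Filter.Eventually.of_forall fun x _ => hb n x)
    (Filter.Eventually.of_forall fun x _ => hc) (by simp) (Filter.Eventually.of_forall fun x _ => hs x)

lemma summ (z : ℝ) (C : ℝ) : Summable (fun m : ℕ => C * (|z| ^ (2 * m) / (2 * m).factorial)) := by
  refine Summable.mul_left _ ?_
  exact (Real.summable_pow_div_factorial |z|).comp_injective (i := fun m => 2 * m) (fun a b h => by simpa using h)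

lemma j0sum (z : ℝ) : HasSum (fun m : ℕ => (-1) ^ m * z ^ (2 * m) / (2 * m).factorial *
     ∫ x in (0:ℝ)..π, sin x ^ (2 * m)) (∫ φ in (0:ℝ)..π, cos (z * sin φ)) := by
  have := hasSum_int _ (summ z 1) (fun m x => (-1) ^ m * z ^ (2 * m) / (2 * m).factorial * sin x ^ (2 * m))
    (fun x => cos (z * sin x)) (fun n => by fun_prop) (fun n x => by
      rw [abs_mul, abs_div, abs_mul, abs_pow, abs_pow, abs_pow]
      simp only [abs_neg, abs_one, one_pow, one_mul, Nat.abs_cast]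
      exact mul_le_of_le_one_right (by positivity) (pow_le_one₀ (abs_nonneg _) (abs_sin_le_one x)))
    (fun x => by
      convert Real.hasSum_cos (z * sin x) using 2 with m
      rw [mul_pow]; ring) 0 π
  simpa only [intervalIntegral.integral_const_mul] using this

lemma prodtel (m : ℕ) : (∏ i ∈ Finset.range m, (2 * (i:ℝ) + 1) / (2 * i + 2)) *
    (∏ i ∈ Finset.range m, (2 * (i:ℝ) + 2) / (2 * i + 3)) = 1 / (2 * m + 1) := by
  induction m with
  | zero => simp
  | succ n ih =>
    rw [Finset.prod_range_succ, Finset.prod_range_succ, mul_mul_mul_comm, ih]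
    have : (2 * (n:ℝ) + 1) ≠ 0 := by positivity
    have : (2 * (n:ℝ) + 2) ≠ 0 := by positivity
    have : (2 * (n:ℝ) + 3) ≠ 0 := by positivity
    push_cast
    rw [show 2 * ((n:ℝ) + 1) + 1 = 2 * n + 3 by ring]
    field_simp

lemma abs_int_le (m : ℕ) : |∫ x in (0:ℝ)..π, sin x ^ (2 * m)| ≤ π := by
  have := intervalIntegral.norm_integral_le_of_norm_le_const (a := 0) (b := π) (C := 1) (f := fun x => sin x ^ (2 * m))
    (fun x _ => by rw [norm_pow]; exact pow_le_one₀ (norm_nonneg _) (abs_sin_le_one x))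
  simpa [abs_of_pos pi_pos] using this

lemma sphere0 (z : ℝ) : z * ∫ θ in (0:ℝ)..π, sin θ * ∫ φ in (0:ℝ)..π, cos (z * sin θ * sin φ) = 2 * π * sin z := by
  have := hasSum_int _ (summ z π) (fun m x => ((-1) ^ m * z ^ (2 * m) / (2 * m).factorial *
     ∫ x in (0:ℝ)..π, sin x ^ (2 * m)) * sin x ^ (2 * m + 1))
    (fun θ => sin θ * ∫ φ in (0:ℝ)..π, cos (z * sin θ * sin φ)) (fun n => by fun_prop) (fun n x => by
      rw [abs_mul, abs_mul, abs_div, abs_mul, abs_pow, abs_pow, abs_pow]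
      simp only [abs_neg, abs_one, one_pow, one_mul, Nat.abs_cast]
      refine (mul_le_of_le_one_right (by positivity) (pow_le_one₀ (abs_nonneg _) (abs_sin_le_one x))).trans ?_
      rw [mul_comm π]
      exact mul_le_mul_of_nonneg_left (abs_int_le n) (by positivity))
    (fun x => by
      refine (congrArg (fun g => HasSum g _) (funext fun m => ?_)).mp ((j0sum (z * sin x)).mul_left (sin x))
      rw [mul_pow]; ring) 0 π
  simp only [intervalIntegral.integral_const_mul, integral_sin_pow_even, integral_sin_pow_odd] at this
  have h1 := this.mul_left z
  have h2 := (Real.hasSum_sin z).mul_left (2 * π)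
  refine h1.unique ?_
  convert h2 using 2 with m
  have := prodtel m
  have e : ((2 * m + 1).factorial : ℝ) = (2 * m + 1) * (2 * m).factorial := by
    rw [Nat.factorial_succ]; push_cast; ring
  rw [e]
  have f0 : ((2 * m).factorial : ℝ) ≠ 0 := by positivity
  have f1 : (2 * (m:ℝ) + 1) ≠ 0 := by positivity
  calc _ = z * ((-1) ^ m * z ^ (2 * m) / (2 * m).factorial * π * 2 * ((∏ i ∈ Finset.range m, (2 * (i:ℝ) + 1) / (2 * i + 2)) *
    (∏ i ∈ Finset.range m, (2 * (i:ℝ) + 2) / (2 * i + 3)))) := by ring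
    _ = _ := by rw [this]; field_simp; ring

lemma rot (z α : ℝ) : ∫ φ in (-π)..π, cos (z * cos (α - φ)) = 2 * ∫ φ in (0:ℝ)..π, cos (z * sin φ) := by
  have hp : Function.Periodic (fun φ => cos (z * sin φ)) π := fun φ => by simp [sin_add_pi]
  have h1 : ∀ φ, cos (z * cos (α - φ)) = (fun φ => cos (z * sin φ)) (φ + (π/2 - α)) := fun φ => by
    simp only
    rw [show φ + (π/2 - α) = π/2 - (α - φ) by ring, sin_pi_div_two_sub]
  simp_rw [h1]
  rw [intervalIntegral.integral_comp_add_right (fun φ => cos (z * sin φ))]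
  have c : ∀ a b, IntervalIntegrable (fun φ => cos (z * sin φ)) volume a b := fun a b =>
    Continuous.intervalIntegrable (by fun_prop) _ _
  rw [← intervalIntegral.integral_add_adjacent_intervals (c _ (-π + (π/2-α) + π)) (c _ _)]
  have e1 := hp.intervalIntegral_add_eq (-π + (π/2-α)) 0
  have e2 := hp.intervalIntegral_add_eq (-π + (π/2-α) + π) 0
  rw [show -π + (π/2-α) + π + π = π + (π/2 - α) by ring] at e2
  rw [e1, e2, zero_add]; ring

lemma sphere (z α : ℝ) : z * ∫ θ in (0:ℝ)..π, ∫ φ in (-π)..π, sin θ * cos (z * sin θ * cos (α - φ)) = 4 * π * sin z := by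
  have : ∀ θ, ∫ φ in (-π)..π, sin θ * cos (z * sin θ * cos (α - φ)) = 2 * (sin θ * ∫ φ in (0:ℝ)..π, cos (z * sin θ * sin φ)) := by
    intro θ
    rw [intervalIntegral.integral_const_mul, rot]; ring
  simp_rw [this]
  rw [intervalIntegral.integral_const_mul]
  linear_combination 2 * sphere0 z

noncomputable def muP : Measure (ℝ × ℝ) := (volume.restrict (Ioi 0)).prod (volume.restrict (Ioo (-π) π))
noncomputable def muQ : Measure (ℝ × ℝ) := (volume.restrict (Ioc 0 π)).prod (volume.restrict (Ioc (-π) π))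

instance : IsFiniteMeasure muQ := by unfold muQ; infer_instance
instance : SFinite muP := by unfold muP; infer_instance

lemma muP_eq : muP = volume.restrict polarCoord.target := by
  rw [muP, Measure.prod_restrict, polarCoord_target, Measure.volume_eq_prod]

lemma polarG (r a φ : ℝ) : ∫ p, p.1 ^ 2 * exp (-p.1 ^ 2 / 2) * cos p.2 * sin (r * (p.1 * cos p.2))
      * cos (a * p.1 * cos (p.2 - φ)) ∂muP =
    π * exp (-(r ^ 2 + a ^ 2) / 2) * ((r + a * cos φ) * exp (-(r * a * cos φ))
      + (r - a * cos φ) * exp (r * a * cos φ)) := by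
  have h := integral_comp_polarCoord_symm (fun k : ℝ × ℝ =>
    k.1 * exp (-k.1 ^ 2 / 2) * exp (-k.2 ^ 2 / 2) * sin (r * k.1)
      * cos (a * cos φ * k.1 + a * sin φ * k.2))
  rw [g2, ← muP_eq] at h
  have hs := sin_sq_add_cos_sq φ
  rw [show exp (-(r + a * cos φ) ^ 2 / 2) = exp (-(r ^ 2 + (a * cos φ) ^ 2) / 2) * exp (-(r * a * cos φ)) by
      rw [← exp_add]; congr 1; ring,
    show exp (-(r - a * cos φ) ^ 2 / 2) = exp (-(r ^ 2 + (a * cos φ) ^ 2) / 2) * exp (r * a * cos φ) by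
      rw [← exp_add]; congr 1; ring] at h
  rw [show exp (-(r ^ 2 + a ^ 2) / 2) = exp (-(r ^ 2 + (a * cos φ) ^ 2) / 2) * exp (-(a * sin φ) ^ 2 / 2) by
      rw [← exp_add]; congr 1; linear_combination (-a^2/2) * (- hs)]
  rw [show ∀ A B C D E F : ℝ, π * (A * B) * (C * D + E * F) = π * (C * (A * D) + E * (A * F)) * B by intros; ring, ← h]
  congr 1
  ext p
  simp only [polarCoord_symm_apply, smul_eq_mul]
  rw [show exp (-p.1 ^ 2 / 2) = exp (-(p.1 * cos p.2) ^ 2 / 2) * exp (-(p.1 * sin p.2) ^ 2 / 2) by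
    rw [← exp_add]; congr 1; linear_combination (-p.1^2/2) * (- sin_sq_add_cos_sq p.2)]
  rw [cos_sub, show a * p.1 * (cos p.2 * cos φ + sin p.2 * sin φ) = a * cos φ * (p.1 * cos p.2) + a * sin φ * (p.1 * sin p.2) by ring]
  ring

noncomputable def HH (t r : ℝ) (p q : ℝ × ℝ) : ℝ :=
  p.1 ^ 2 * exp (-p.1 ^ 2 / 2) * cos p.2 * sin (r * (p.1 * cos p.2))
      * (sin q.1 * cos (t * p.1 * sin q.1 * cos (p.2 - q.2)))

lemma HHint (t r : ℝ) : Integrable (Function.uncurry (HH t r)) (muP.prod muQ) := by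
  have h1 : Integrable (fun p : ℝ × ℝ => (p.1 ^ 2 * exp (-p.1 ^ 2 / 2)) * (1:ℝ)) muP :=
    (gi2.restrict (s := Ioi 0)).mul_prod (integrable_const (1:ℝ))
  have h2 := h1.mul_prod (integrable_const (μ := muQ) (1:ℝ))
  have h3 := h2.mul_bdd (g := fun z : (ℝ × ℝ) × (ℝ × ℝ) => cos z.1.2 * sin (r * (z.1.1 * cos z.1.2))
      * (sin z.2.1 * cos (t * z.1.1 * sin z.2.1 * cos (z.1.2 - z.2.2)))) (c := 1)
    (Continuous.aestronglyMeasurable (by fun_prop)) (Filter.Eventually.of_forall fun z => by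
      simp only [norm_mul, Real.norm_eq_abs]
      exact mul_le_one₀ (mul_le_one₀ (abs_cos_le_one _) (abs_nonneg _) (abs_sin_le_one _)) (by positivity)
        (mul_le_one₀ (abs_sin_le_one _) (abs_nonneg _) (abs_cos_le_one _)))
  refine h3.congr (Filter.Eventually.of_forall fun z => ?_)
  simp only [Function.uncurry, HH]; ring

lemma intQ (f : ℝ × ℝ → ℝ) (hf : Continuous f) : ∫ q, f q ∂muQ = ∫ θ in (0:ℝ)..π, ∫ φ in (-π)..π, f (θ, φ) := by
  have hi : Integrable f muQ := by
    have := (hf.continuousOn (s := Icc 0 π ×ˢ Icc (-π) π)).integrableOn_compact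
      (μ := (volume : Measure (ℝ × ℝ))) (isCompact_Icc.prod isCompact_Icc)
    rw [muQ, Measure.prod_restrict]
    exact this.mono_set (prod_mono Ioc_subset_Icc_self Ioc_subset_Icc_self)
  rw [muQ] at hi ⊢
  rw [integral_prod _ hi, intervalIntegral.integral_of_le pi_pos.le]
  simp_rw [intervalIntegral.integral_of_le (show -π ≤ π by linarith [pi_pos])]

lemma left1 (t r : ℝ) : t * ∫ p, ∫ q, HH t r p q ∂muQ ∂muP =
    4 * π * ∫ p, p.1 * exp (-p.1 ^ 2 / 2) * cos p.2 * sin (r * (p.1 * cos p.2)) * sin (t * p.1) ∂muP := by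
  rw [← integral_const_mul, ← integral_const_mul]
  congr 1; ext p
  unfold HH
  rw [integral_const_mul, intQ (fun q => sin q.1 * cos (t * p.1 * sin q.1 * cos (p.2 - q.2))) (by fun_prop)]
  simp only
  linear_combination p.1 * exp (-p.1 ^ 2 / 2) * cos p.2 * sin (r * (p.1 * cos p.2)) * sphere (t * p.1) p.2

lemma per_even (f : ℝ → ℝ) (hf : Continuous f) (he : ∀ x, f (-x) = f x) : ∫ x in (-π)..π, f x = 2 * ∫ x in (0:ℝ)..π, f x := by
  rw [← intervalIntegral.integral_add_adjacent_intervals (b := 0) (hf.intervalIntegrable _ _) (hf.intervalIntegrable _ _)]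
  have := intervalIntegral.integral_comp_neg (a := 0) (b := π) f
  simp only [he, neg_zero] at this
  rw [← this]; ring

lemma refl_int (f : ℝ → ℝ) : ∫ x in (0:ℝ)..π, f (π - x) = ∫ x in (0:ℝ)..π, f x := by
  rw [intervalIntegral.integral_comp_sub_left f π]; simp

lemma J1_alt (x : ℝ) : ∫ α in (-π)..π, cos α * sin (x * cos α) = 2 * π * J1 x := by
  have hp : Function.Periodic (fun α => sin α * sin (x * sin α)) (2 * π) := fun φ => by simp
  have h1 : ∀ α, cos α * sin (x * cos α) = (fun α => sin α * sin (x * sin α)) (α + π/2) := fun φ => by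
    simp [sin_add_pi_div_two]
  simp_rw [h1]
  rw [intervalIntegral.integral_comp_add_right (fun α => sin α * sin (x * sin α))]
  have e1 := hp.intervalIntegral_add_eq (-π + π/2) (-π)
  rw [show -π + π/2 + 2 * π = π + π/2 by ring, show -π + 2 * π = π by ring] at e1
  rw [e1, per_even _ (by fun_prop) (by intro y; simp)]
  have h2 : ∫ φ in (0:ℝ)..π, cos (φ - x * sin φ) = ∫ φ in (0:ℝ)..π, (cos φ * cos (x * sin φ) + sin φ * sin (x * sin φ)) := by
    simp_rw [cos_sub]
  have h3 : ∫ φ in (0:ℝ)..π, cos φ * cos (x * sin φ) = 0 := by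
    have := refl_int (fun φ => cos φ * cos (x * sin φ))
    simp only [cos_pi_sub, sin_pi_sub, neg_mul, intervalIntegral.integral_neg] at this
    linarith
  rw [J1, h2, intervalIntegral.integral_add (Continuous.intervalIntegrable (by fun_prop) _ _)
    (Continuous.intervalIntegrable (by fun_prop) _ _), h3, zero_add, ← mul_assoc,
    show 2 * π * (1 / π) = 2 by field_simp]

lemma left2 (t r : ℝ) : ∫ p, p.1 * exp (-p.1 ^ 2 / 2) * cos p.2 * sin (r * (p.1 * cos p.2)) * sin (t * p.1) ∂muP =
    2 * π * ∫ ω in Ioi (0 : ℝ), ω * exp (-ω ^ 2 / 2) * J1 (r * ω) * sin (t * ω) := by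
  have h1 : Integrable (fun p : ℝ × ℝ => (p.1 * exp (-p.1 ^ 2 / 2)) * (1:ℝ)) muP :=
    (gi1.restrict (s := Ioi 0)).mul_prod (integrable_const (1:ℝ))
  have h3 := h1.mul_bdd (g := fun z : ℝ × ℝ => cos z.2 * sin (r * (z.1 * cos z.2)) * sin (t * z.1)) (c := 1)
    (Continuous.aestronglyMeasurable (by fun_prop)) (Filter.Eventually.of_forall fun z => by
      simp only [norm_mul, Real.norm_eq_abs]
      exact mul_le_one₀ (mul_le_one₀ (abs_cos_le_one _) (abs_nonneg _) (abs_sin_le_one _)) (by positivity)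
        (abs_sin_le_one _))
  have h4 : Integrable (fun p : ℝ × ℝ => p.1 * exp (-p.1 ^ 2 / 2) * cos p.2 * sin (r * (p.1 * cos p.2)) * sin (t * p.1)) muP := by
    refine h3.congr (Filter.Eventually.of_forall fun z => ?_)
    simp only; ring
  rw [muP] at h4 ⊢
  rw [integral_prod _ h4, ← integral_const_mul]
  congr 1; ext ω
  simp only
  have := J1_alt (r * ω)
  rw [intervalIntegral.integral_of_le (by linarith [pi_pos]), integral_Ioc_eq_integral_Ioo] at this
  have e : ∀ y, ω * exp (-ω ^ 2 / 2) * cos y * sin (r * (ω * cos y)) * sin (t * ω) =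
    (ω * exp (-ω ^ 2 / 2) * sin (t * ω)) * (cos y * sin (r * ω * cos y)) := by
    intro y; rw [mul_assoc r]; ring
  simp_rw [e]
  rw [integral_const_mul, this]; ring

lemma besselI_int (j : ℕ) (z : ℝ) : ∫ φ in (-π)..π, exp (z * cos φ) * cos (j * φ) = 2 * π * besselI j z := by
  rw [per_even _ (by fun_prop) (by intro y; simp), besselI]
  field_simp

lemma besselI_cont (j : ℕ) : Continuous (besselI j) := by
  unfold besselI
  exact continuous_const.mul (intervalIntegral.continuous_parametric_intervalIntegral_of_continuous'
    (f := fun z φ => exp (z * cos φ) * cos (j * φ)) (by simp only [Function.uncurry_def]; fun_prop) _ _)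

lemma angP (r a : ℝ) : ∫ φ in (-π)..π, (r - a * cos φ) * exp (r * a * cos φ) =
    2 * π * (r * besselI 0 (r * a) - a * besselI 1 (r * a)) := by
  have h0 := besselI_int 0 (r * a)
  have h1 := besselI_int 1 (r * a)
  simp only [Nat.cast_zero, zero_mul, cos_zero, mul_one, Nat.cast_one, one_mul] at h0 h1
  have e : ∀ φ, (r - a * cos φ) * exp (r * a * cos φ) = r * exp (r * a * cos φ) - a * (exp (r * a * cos φ) * cos φ) := by
    intro φ; ring
  simp_rw [e]
  rw [intervalIntegral.integral_sub (Continuous.intervalIntegrable (by fun_prop) _ _)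
    (Continuous.intervalIntegrable (by fun_prop) _ _), intervalIntegral.integral_const_mul,
    intervalIntegral.integral_const_mul, h0, h1]; ring

lemma angM (r a : ℝ) : ∫ φ in (-π)..π, (r + a * cos φ) * exp (-(r * a * cos φ)) =
    2 * π * (r * besselI 0 (r * a) - a * besselI 1 (r * a)) := by
  rw [← angP, per_even _ (by fun_prop) (by intro y; simp), per_even _ (by fun_prop) (by intro y; simp),
    ← refl_int]
  simp only [cos_pi_sub, mul_neg, neg_neg, ← sub_eq_add_neg]

noncomputable def KK (t r s : ℝ) : ℝ :=
  exp (-(r ^ 2 + (t * s) ^ 2) / 2) * (s * (r * besselI 0 (r * (t * s)) - (t * s) * besselI 1 (r * (t * s))))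

lemma KK_cont (t r : ℝ) : Continuous (KK t r) := by
  unfold KK
  have := besselI_cont 0
  have := besselI_cont 1
  fun_prop

lemma right1 (t r : ℝ) : ∫ q, ∫ p, HH t r p q ∂muP ∂muQ = 4 * π ^ 2 * ∫ θ in (0:ℝ)..π, KK t r (sin θ) := by
  have e : ∀ q : ℝ × ℝ, ∫ p, HH t r p q ∂muP = sin q.1 * (π * exp (-(r ^ 2 + (t * sin q.1) ^ 2) / 2) * ((r + (t * sin q.1) * cos q.2) * exp (-(r * (t * sin q.1) * cos q.2))
      + (r - (t * sin q.1) * cos q.2) * exp (r * (t * sin q.1) * cos q.2))) := by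
    intro q
    rw [← polarG, ← integral_const_mul]
    congr 1; ext p
    unfold HH
    rw [show t * p.1 * sin q.1 = t * sin q.1 * p.1 by ring]; ring
  simp_rw [e]
  rw [intQ _ (by fun_prop), ← intervalIntegral.integral_const_mul]
  congr 1; ext θ
  simp only
  rw [intervalIntegral.integral_const_mul, intervalIntegral.integral_const_mul,
    intervalIntegral.integral_add (Continuous.intervalIntegrable (by fun_prop) _ _)
    (Continuous.intervalIntegrable (by fun_prop) _ _), angP, angM, KK]
  ring

lemma half (f : ℝ → ℝ) (hf : Continuous f) : ∫ θ in (0:ℝ)..π, f (sin θ) = 2 * ∫ θ in (0:ℝ)..(π/2), f (sin θ) := by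
  have c : Continuous (fun θ => f (sin θ)) := by fun_prop
  rw [← intervalIntegral.integral_add_adjacent_intervals (b := π/2) (c.intervalIntegrable _ _) (c.intervalIntegrable _ _)]
  have := intervalIntegral.integral_comp_sub_left (a := 0) (b := π/2) (fun θ => f (sin θ)) π
  simp only [sin_pi_sub, sub_zero] at this
  rw [show π - π/2 = π/2 by ring] at this
  rw [← this]; ring

lemma subst (g : ℝ → ℝ) : ∫ ξ in (0:ℝ)..1, g ξ / (√ξ * √(2 - ξ)) = ∫ θ in (0:ℝ)..(π/2), g (1 - sin θ) := by
  have him : (fun θ => 1 - sin θ) '' Ioo 0 (π/2) = Ioo 0 1 := by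
    ext y
    constructor
    · rintro ⟨x, hx, rfl⟩
      have h1 : 0 < sin x := sin_pos_of_pos_of_lt_pi hx.1 (by linarith [hx.2, pi_pos])
      have h2 : sin x < 1 := by
        rw [← sin_pi_div_two]; exact sin_lt_sin_of_lt_of_le_pi_div_two (by linarith [hx.1, pi_pos]) le_rfl hx.2
      constructor <;> simp only <;> linarith
    · rintro ⟨h1, h2⟩
      refine ⟨arcsin (1 - y), ⟨arcsin_pos.2 (by linarith), arcsin_lt_pi_div_two.2 (by linarith)⟩, ?_⟩
      simp only
      rw [sin_arcsin (by linarith) (by linarith)]; ring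
  rw [intervalIntegral.integral_of_le zero_le_one, integral_Ioc_eq_integral_Ioo, ← him,
    integral_image_eq_integral_abs_deriv_smul (f' := fun θ => -cos θ) measurableSet_Ioo
      (fun x _ => ((hasDerivAt_sin x).const_sub 1).hasDerivWithinAt)
      (fun x hx y hy h => injOn_sin ⟨by linarith [hx.1, pi_pos], hx.2.le⟩ ⟨by linarith [hy.1, pi_pos], hy.2.le⟩ (by simpa using h)),
    intervalIntegral.integral_of_le (by positivity), integral_Ioc_eq_integral_Ioo]
  refine setIntegral_congr_fun measurableSet_Ioo fun x hx => ?_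
  have hc : 0 < cos x := cos_pos_of_mem_Ioo ⟨by linarith [hx.1, pi_pos], hx.2⟩
  simp only [smul_eq_mul, abs_neg, abs_of_pos hc]
  rw [← Real.sqrt_mul (by linarith [sin_le_one x]),
    show (1 - sin x) * (2 - (1 - sin x)) = cos x ^ 2 by linear_combination - sin_sq_add_cos_sq x, Real.sqrt_sq hc.le]
  field_simp

lemma Jjn_eq (j n : ℕ) (t r : ℝ) : Jjn j n t r =
    ∫ θ in (0:ℝ)..(π/2), exp (-(r ^ 2 + (t * sin θ) ^ 2) / 2) * besselI j (r * (t * sin θ)) * sin θ ^ n := by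
  rw [Jjn, subst (fun ξ => exp (-(r - t + t * ξ) ^ 2 / 2) * Itilde j (r * t * (1 - ξ)) * (1 - ξ) ^ n)]
  congr 1; ext θ
  simp only [Itilde, sub_sub_cancel]
  rw [← mul_assoc, ← exp_add, mul_assoc r t]
  congr 3; ring

theorem stmt_15 (t r : ℝ) (ht : 0 ≤ t) (hr : 0 ≤ r) :
    (∫ ω in Set.Ioi (0 : ℝ), ω * Real.exp (-ω ^ 2 / 2) * J1 (r * ω) * Real.sin (t * ω)) =
      -(t ^ 2) * Jjn 1 2 t r + r * t * Jjn 0 1 t r := by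
  have h1 := left1 t r
  rw [left2, integral_integral_swap (HHint t r), right1, half _ (KK_cont t r)] at h1
  have hb0 := besselI_cont 0
  have hb1 := besselI_cont 1
  have h2 : -(t ^ 2) * Jjn 1 2 t r + r * t * Jjn 0 1 t r = t * ∫ θ in (0:ℝ)..(π/2), KK t r (sin θ) := by
    rw [Jjn_eq, Jjn_eq, ← intervalIntegral.integral_const_mul, ← intervalIntegral.integral_const_mul,
      ← intervalIntegral.integral_const_mul,
      ← intervalIntegral.integral_add (Continuous.intervalIntegrable (by fun_prop) _ _)
        (Continuous.intervalIntegrable (by fun_prop) _ _)]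
    congr 1; ext θ
    unfold KK; ring
  rw [h2]
  have hpi : (8 * π ^ 2) ≠ 0 := by positivity
  apply mul_left_cancel₀ hpi
  linear_combination -h1
end
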